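/- Let T : C(X,ℂ) → C(Y,ℂ) be a bijective map between the sup-normed Banach algebras of continuous complex-valued functions on compact Hausdorff spaces X and Y, satisfying ‖T(f+g)‖ = ‖T(f)+T(g)‖, ‖T(fg)‖ = ‖T(f)T(g)‖, and T(conj f) = conj(T f) for all f, g. Then there exist a continuous function u : Y → {1, −1}, a homeomorphism τ : Y → X, and a clopen subset K ⊆ Y such that T(f)(y) = u(y)·f(τ(y)) for y ∈ K and T(f)(y) = u(y)·conj(f(τ(y))) for y ∈ Y \ K, for all f ∈ C(X,ℂ) and y ∈ Y. -/

import Mathlib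

variable {X Y : Type*} [TopologicalSpace X] [CompactSpace X] [T2Space X]
  [TopologicalSpace Y] [CompactSpace Y] [T2Space Y]

/-- A bijective solution of the Fischer–Muszély equation from an abelian group onto a real normed
space is additive. -/
theorem map_add_of_norm_map_add_eq {G E : Type*} [AddCommGroup G] [NormedAddCommGroup E]
    [NormedSpace ℝ E] (T : G → E) (hbij : Function.Bijective T)
    (h : ∀ f g, ‖T (f + g)‖ = ‖T f + T g‖) (f g : G) : T (f + g) = T f + T g := by
  have h0 : T 0 = 0 := by
    have := h 0 0
    rw [add_zero, ← two_smul ℝ (T 0), norm_smul] at this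
    norm_num at this
    exact norm_eq_zero.mp (by linarith)
  have hneg : ∀ f, T (-f) = -T f := fun f => by
    have := h f (-f)
    rw [add_neg_cancel, h0, norm_zero] at this
    exact (neg_eq_of_add_eq_zero_right (norm_eq_zero.mp this.symm)).symm
  have hsub : ∀ f g, ‖T f - T g‖ = ‖T (f - g)‖ := fun f g => by
    rw [sub_eq_add_neg, ← hneg, ← h, ← sub_eq_add_neg]
  let e := Equiv.ofBijective T hbij
  have he : ∀ a, T (e.symm a) = a := e.apply_symm_apply
  have hes : ∀ g, e.symm (T g) = g := e.symm_apply_apply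
  let U : G → E ≃ᵢ E := fun k =>
    { toEquiv := (e.symm.trans (Equiv.addRight k)).trans e
      isometry_toFun := Isometry.of_dist_eq fun a b => by
        change dist (T (e.symm a + k)) (T (e.symm b + k)) = _
        rw [dist_eq_norm, hsub, add_sub_add_right_eq_sub, ← hsub, he, he, dist_eq_norm] }
  have hs0 : e.symm 0 = 0 := by rw [← h0, hes]
  let L : G → E ≃ₗᵢ[ℝ] E := fun k => (U k).toRealLinearIsometryEquiv
  have hL : ∀ k a, L k a = T (e.symm a + k) - T k := fun k a => by
    have h1 : L k a = T (e.symm a + k) - T (e.symm 0 + k) :=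
      (U k).toRealLinearIsometryEquiv_apply a
    rw [h1, hs0, zero_add]
  have hsymm : ∀ a b : E, L (e.symm b) a - a = L (e.symm a) b - b := fun a b => by
    rw [hL, hL, he, he, add_comm (e.symm a)]
    abel
  have hbound : ∀ (a b : E) (t : ℝ), ‖t • (L (e.symm b) a - a)‖ ≤ 2 * ‖a‖ := fun a b t => by
    have : t • (L (e.symm b) a - a) = L (e.symm (t • b)) a - a := by
      rw [hsymm, hsymm a, map_smul, smul_sub]
    rw [this]
    refine (norm_sub_le _ _).trans ?_
    rw [LinearIsometryEquiv.norm_map]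
    linarith
  have hzero : ∀ a b : E, L (e.symm b) a - a = 0 := fun a b => by
    by_contra hne
    have hpos := norm_pos_iff.mpr hne
    have := hbound a b ((2 * ‖a‖ + 1) / ‖L (e.symm b) a - a‖)
    rw [norm_smul, Real.norm_of_nonneg (by positivity), div_mul_cancel₀ _ hpos.ne'] at this
    linarith
  have := hzero (T f) (T g)
  rw [hL, hes, hes, sub_sub, sub_eq_zero] at this
  rw [this, add_comm]

/-- A complex-valued Urysohn function separating a point from a closed set. -/
theorem exists_bump {Z : Type*} [TopologicalSpace Z] [CompactSpace Z] [T2Space Z]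
    {s : Set Z} (hs : IsClosed s) {y : Z} (hy : y ∉ s) :
    ∃ φ : C(Z, ℂ), φ y = 1 ∧ (∀ z ∈ s, φ z = 0) ∧ ∀ z, ‖φ z‖ ≤ 1 := by
  obtain ⟨f, hf0, hf1, hf⟩ := exists_continuous_zero_one_of_isClosed hs
    (isClosed_singleton (x := y)) (Set.disjoint_singleton_right.mpr hy)
  refine ⟨⟨fun z => (f z : ℂ), by fun_prop⟩, ?_, fun z hz => ?_, fun z => ?_⟩
  · simp [hf1 rfl]
  · simp [hf0 hz]
  · simpa [abs_of_nonneg (hf z).1] using (hf z).2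

theorem norm_apply_map_mul_le {X Y : Type*} [TopologicalSpace X] [TopologicalSpace Y]
    [CompactSpace Y] [T2Space Y] (T : C(X, ℂ) → C(Y, ℂ)) (hbij : Function.Bijective T)
    (h0 : T 0 = 0) (h2 : ∀ f g : C(X, ℂ), ‖T (f * g)‖ = ‖T f * T g‖)
    (f g : C(X, ℂ)) (y : Y) : ‖T (f * g) y‖ ≤ ‖T f y‖ * ‖T g y‖ := by
  have key : ∀ ε > 0, ‖T (f * g) y‖ - ε ≤ (‖T f y‖ + ε) * (‖T g y‖ + ε) := by
    intro ε hε
    have hV : {z | ‖T f z‖ < ‖T f y‖ + ε ∧ ‖T g z‖ < ‖T g y‖ + ε ∧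
        ‖T (f * g) y‖ - ε < ‖T (f * g) z‖} ∈ nhds y := by
      refine IsOpen.mem_nhds ?_ ⟨by linarith, by linarith, by linarith⟩
      exact (isOpen_lt (T f).continuous.norm continuous_const).inter
        ((isOpen_lt (T g).continuous.norm continuous_const).inter
          (isOpen_lt continuous_const (T (f * g)).continuous.norm))
    obtain ⟨V, hVy, hVc, hVs⟩ := exists_mem_nhds_isClosed_subset hV
    obtain ⟨φ, hφy, hφ0, hφ1⟩ := exists_bump (s := (interior V)ᶜ) (y := y)
      isOpen_interior.isClosed_compl (by simpa using mem_interior_iff_mem_nhds.mpr hVy)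
    have hφV : ∀ z ∉ V, φ z = 0 := fun z hz => hφ0 z fun h => hz (interior_subset h)
    obtain ⟨k, rfl⟩ := hbij.2 φ
    have hsupp : ∀ z ∉ V, T (k * k) z = 0 := by
      intro z hz
      obtain ⟨ψ, hψz, hψ0, -⟩ := exists_bump hVc hz
      obtain ⟨l, rfl⟩ := hbij.2 ψ
      have hkl : T (k * l) = T 0 := by
        rw [h0, ← norm_eq_zero, h2, norm_eq_zero]
        ext w
        by_cases hw : w ∈ V
        · simp [hψ0 w hw]
        · simp [hφV w hw]
      have hkl := hbij.1 hkl
      have : T (k * k) * T l = 0 := by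
        rw [← norm_eq_zero, ← h2, mul_assoc, hkl, mul_zero, h0, norm_zero]
      simpa [hψz] using DFunLike.congr_fun this z
    have hone : 1 ≤ ‖T (k * k)‖ := by
      rw [h2]
      simpa [hφy] using (T k * T k).norm_coe_le_norm y
    have hfac : ∀ a : C(X, ℂ), (∀ z ∈ V, ‖T a z‖ ≤ ‖T a y‖ + ε) →
        ‖T (a * k)‖ ≤ ‖T a y‖ + ε := by
      intro a ha
      rw [h2, ContinuousMap.norm_le _ (by positivity)]
      intro z
      rw [ContinuousMap.mul_apply, norm_mul]
      by_cases hz : z ∈ V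
      · calc _ ≤ (‖T a y‖ + ε) * 1 := mul_le_mul (ha z hz) (hφ1 z) (norm_nonneg _) (by positivity)
          _ = _ := mul_one _
      · rw [hφV z hz, norm_zero, mul_zero]
        positivity
    have hupper : ‖T (f * g) * T (k * k)‖ ≤ (‖T f y‖ + ε) * (‖T g y‖ + ε) := by
      rw [← h2, mul_mul_mul_comm, h2]
      exact (norm_mul_le _ _).trans (mul_le_mul (hfac f fun z hz => (hVs hz).1.le)
        (hfac g fun z hz => (hVs hz).2.1.le) (norm_nonneg _) (by positivity))
    rcases le_or_gt (‖T (f * g) y‖ - ε) 0 with hm | hm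
    · exact hm.trans (by positivity)
    · have hlower : ‖T (k * k)‖ ≤ ‖T (f * g) * T (k * k)‖ / (‖T (f * g) y‖ - ε) := by
        rw [ContinuousMap.norm_le _ (by positivity)]
        intro z
        rw [le_div_iff₀ hm]
        by_cases hz : z ∈ V
        · refine le_trans ?_ ((T (f * g) * T (k * k)).norm_coe_le_norm z)
          rw [ContinuousMap.mul_apply, norm_mul, mul_comm]
          exact mul_le_mul_of_nonneg_right (hVs hz).2.2.le (norm_nonneg _)
        · rw [hsupp z hz, norm_zero, zero_mul]
          positivity
      have := (le_div_iff₀ hm).mp (hone.trans hlower)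
      linarith
  have hl : Filter.Tendsto (fun ε : ℝ => ‖T (f * g) y‖ - ε) (nhdsWithin 0 (Set.Ioi 0))
      (nhds (‖T (f * g) y‖ - 0)) :=
    ((by fun_prop : Continuous fun ε : ℝ => ‖T (f * g) y‖ - ε).tendsto 0).mono_left
      nhdsWithin_le_nhds
  have hr : Filter.Tendsto (fun ε : ℝ => (‖T f y‖ + ε) * (‖T g y‖ + ε))
      (nhdsWithin 0 (Set.Ioi 0)) (nhds ((‖T f y‖ + 0) * (‖T g y‖ + 0))) :=
    ((by fun_prop : Continuous fun ε : ℝ => (‖T f y‖ + ε) * (‖T g y‖ + ε)).tendsto 0).mono_left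
      nhdsWithin_le_nhds
  simpa using le_of_tendsto_of_tendsto hl hr
    (eventually_nhdsWithin_of_forall fun ε hε => key ε hε)

/-- The usual product is the only unital, contractive, star-compatible biadditive product
on `ℂ`. -/
theorem biadditive_eq_mul (B : ℂ → ℂ → ℂ) (hl : ∀ a a' b, B (a + a') b = B a b + B a' b)
    (hr : ∀ a b b', B a (b + b') = B a b + B a b') (hB : ∀ a b, ‖B a b‖ ≤ ‖a‖ * ‖b‖)
    (h1l : ∀ b, B 1 b = b) (h1r : ∀ a, B a 1 = a)
    (hstar : ∀ a b, B (star a) (star b) = star (B a b)) (a b : ℂ) : B a b = a * b := by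
  have hsl : ∀ (t : ℝ) (a b : ℂ), B (t * a) b = t * B a b := fun t a b => by
    let F : ℂ →+ ℂ := AddMonoidHom.mk' (B · b) fun x y => hl x y b
    have hF : Continuous F := AddMonoidHomClass.continuous_of_bound F ‖b‖ fun x => by
      rw [mul_comm]; exact hB x b
    simpa [F] using map_real_smul F hF t a
  have hsr : ∀ (t : ℝ) (a b : ℂ), B a (t * b) = t * B a b := fun t a b => by
    let F : ℂ →+ ℂ := AddMonoidHom.mk' (B a) fun x y => hr a x y
    have hF : Continuous F := AddMonoidHomClass.continuous_of_bound F ‖a‖ fun x => hB a x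
    simpa [F] using map_real_smul F hF t b
  have hI : B Complex.I Complex.I = -1 := by
    have hneg : ∀ a b : ℂ, B (-a) (-b) = B a b := fun a b => by
      have h1 := hsl (-1) a (-b)
      have h2 := hsr (-1) a b
      simp only [Complex.ofReal_neg, Complex.ofReal_one, neg_mul, one_mul] at h1 h2
      rw [h1, h2, neg_neg]
    have him : (B Complex.I Complex.I).im = 0 := by
      have := hstar Complex.I Complex.I
      simp only [Complex.star_def, Complex.conj_I] at this
      rw [hneg] at this
      exact Complex.conj_eq_iff_im.mp this.symm
    have hre1 : -1 ≤ (B Complex.I Complex.I).re := by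
      have := (Complex.abs_re_le_norm _).trans (hB Complex.I Complex.I)
      simp only [Complex.norm_I, mul_one] at this
      exact (abs_le.mp this).1
    have hsq : B (1 + Complex.I) (1 + Complex.I) =
        ((1 + (B Complex.I Complex.I).re : ℝ) : ℂ) + (2 : ℝ) * Complex.I := by
      have hc : B Complex.I Complex.I = ((B Complex.I Complex.I).re : ℂ) :=
        (Complex.ext rfl (by simpa using him))
      rw [hl, hr, hr, h1l, h1r, h1l]
      push_cast
      rw [← hc]
      ring
    have hre2 := pow_le_pow_left₀ (norm_nonneg _) (hB (1 + Complex.I) (1 + Complex.I)) 2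
    rw [hsq, mul_pow, Complex.sq_norm, Complex.sq_norm, Complex.normSq_add_mul_I] at hre2
    have h11 : Complex.normSq (1 + Complex.I) = 2 := by
      norm_num [Complex.normSq_apply]
    rw [h11] at hre2
    refine Complex.ext ?_ (by simpa using him)
    simp only [Complex.neg_re, Complex.one_re]
    nlinarith
  have hbI : B Complex.I b = Complex.I * b := by
    conv_lhs => rw [← Complex.re_add_im b, hr, hsr, hI, ← mul_one (b.re : ℂ), hsr, h1r]
    conv_rhs => rw [← Complex.re_add_im b]
    linear_combination (-(b.im : ℂ)) * Complex.I_mul_I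
  conv_lhs => rw [← Complex.re_add_im a, hl, hsl, hbI, ← mul_one (a.re : ℂ), hsl, h1l]
  conv_rhs => rw [← Complex.re_add_im a]
  ring

theorem map_mul_of_norm_apply_mul_le {X Y : Type*} [TopologicalSpace X] [TopologicalSpace Y]
    (R : C(X, ℂ) → C(Y, ℂ)) (hbij : Function.Bijective R)
    (hadd : ∀ f g, R (f + g) = R f + R g) (hone : R 1 = 1)
    (hmul : ∀ f g y, ‖R (f * g) y‖ ≤ ‖R f y‖ * ‖R g y‖)
    (hstar : ∀ f, R (star f) = star (R f)) (f g : C(X, ℂ)) : R (f * g) = R f * R g := by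
  ext y
  let e := Equiv.ofBijective R hbij
  let σ : ℂ → C(X, ℂ) := fun a => e.symm (ContinuousMap.const Y a)
  have hσ : ∀ a, R (σ a) = ContinuousMap.const Y a := fun a => e.apply_symm_apply _
  let F : C(X, ℂ) →+ C(Y, ℂ) := AddMonoidHom.mk' R hadd
  have hsub : ∀ f g, R (f - g) = R f - R g := map_sub F
  have hzero : ∀ f g g', R g y = R g' y → R (f * g) y = R (f * g') y := by
    intro f g g' hg
    have := hmul f (g - g') y
    rw [mul_sub, hsub, hsub, ContinuousMap.sub_apply, ContinuousMap.sub_apply, hg, sub_self,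
      norm_zero, mul_zero] at this
    exact sub_eq_zero.mp (norm_le_zero_iff.mp this)
  have hcongr : ∀ f f' g g', R f y = R f' y → R g y = R g' y → R (f * g) y = R (f' * g') y := by
    intro f f' g g' hf hg
    rw [hzero f g g' hg, mul_comm, hzero g' f f' hf, mul_comm]
  have hB := biadditive_eq_mul (fun a b => R (σ a * σ b) y)
    (fun a a' b => by
      rw [← ContinuousMap.add_apply, ← hadd, ← add_mul]
      exact hcongr _ _ _ _ (by simp [hadd, hσ]) rfl)
    (fun a b b' => by
      rw [← ContinuousMap.add_apply, ← hadd, ← mul_add]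
      exact hcongr _ _ _ _ rfl (by simp [hadd, hσ]))
    (fun a b => by simpa [hσ] using hmul (σ a) (σ b) y)
    (fun b => by
      rw [hcongr (σ 1) 1 (σ b) (σ b) (by simp [hσ, hone]) rfl]
      simp [hσ])
    (fun a => by
      rw [hcongr (σ a) (σ a) (σ 1) 1 rfl (by simp [hσ, hone])]
      simp [hσ])
    (fun a b => by
      rw [← ContinuousMap.star_apply, ← hstar, star_mul']
      exact hcongr _ _ _ _ (by simp [hstar, hσ]) (by simp [hstar, hσ]))
    (R f y) (R g y)
  rw [ContinuousMap.mul_apply, ← hB]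
  exact hcongr _ _ _ _ (by simp [hσ]) (by simp [hσ])

/-- A ring endomorphism of `ℂ` commuting with conjugation is the identity or conjugation. -/
theorem ringHom_eq_id_or_conj_of_map_star (ι : ℂ →+* ℂ) (h : ∀ z, ι (star z) = star (ι z)) :
    (ι Complex.I = Complex.I ∧ ∀ z, ι z = z) ∨
      (ι Complex.I = -Complex.I ∧ ∀ z, ι z = star z) := by
  have him : ∀ r : ℝ, ι r = ((ι r).re : ℂ) := fun r => by
    have := h r
    rw [Complex.star_def, Complex.conj_ofReal] at this
    exact (Complex.conj_eq_iff_re.mp this.symm).symm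
  let ρ : ℝ →+* ℝ :=
    { toFun := fun r => (ι r).re
      map_one' := by simp
      map_zero' := by simp
      map_add' := fun r s => by simp
      map_mul' := fun r s => by
        rw [Complex.ofReal_mul, map_mul, him r, him s]
        simp }
  have hreal : ∀ r : ℝ, ι r = r := fun r => by
    rw [him r]
    exact congrArg _ (DFunLike.congr_fun (Subsingleton.elim ρ (RingHom.id ℝ)) r)
  let A : ℂ →ₐ[ℝ] ℂ := { ι with commutes' := hreal }
  rcases Complex.real_algHom_eq_id_or_conj A with hA | hA
  · have : ∀ z, ι z = z := fun z => DFunLike.congr_fun hA z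
    exact Or.inl ⟨this _, this⟩
  · have : ∀ z, ι z = star z := fun z => DFunLike.congr_fun hA z
    exact Or.inr ⟨by simp [this], this⟩

theorem exists_eq_apply_or_star_apply (ρ : C(X, ℂ) →+* ℂ) (hρ : ∀ f, ρ (star f) = star (ρ f)) :
    ∃ x, (ρ (algebraMap ℂ _ Complex.I) = Complex.I ∧ ∀ f, ρ f = f x) ∨
      (ρ (algebraMap ℂ _ Complex.I) = -Complex.I ∧ ∀ f, ρ f = star (f x)) := by
  have hchar : ∀ χ : C(X, ℂ) →ₐ[ℂ] ℂ, ∃ x, ∀ f, χ f = f x := fun χ => by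
    obtain ⟨x, hx⟩ := (WeakDual.CharacterSpace.continuousMapEval_bijective X ℂ).2
      (WeakDual.CharacterSpace.equivAlgHom.symm χ)
    exact ⟨x, fun f => (DFunLike.congr_fun hx f).symm⟩
  rcases ringHom_eq_id_or_conj_of_map_star (ρ.comp (algebraMap ℂ C(X, ℂ))) (fun z => by
    simp only [RingHom.comp_apply, algebraMap_star_comm, hρ]) with ⟨hI, hz⟩ | ⟨hI, hz⟩
  · obtain ⟨x, hx⟩ := hchar { ρ with commutes' := hz }
    exact ⟨x, Or.inl ⟨hI, hx⟩⟩
  · obtain ⟨x, hx⟩ := hchar { (starRingEnd ℂ).comp ρ with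
      commutes' := fun z => by
        change star (ρ (algebraMap ℂ _ z)) = z
        rw [← RingHom.comp_apply, hz, star_star] }
    exact ⟨x, Or.inr ⟨hI, fun f => by rw [← hx f]; exact (star_star _).symm⟩⟩

theorem exists_homeomorph_of_star_ringHom (R : C(X, ℂ) →+* C(Y, ℂ)) (hbij : Function.Bijective R)
    (hstar : ∀ f, R (star f) = star (R f)) :
    ∃ (τ : Y ≃ₜ X) (K : Set Y), IsClopen K ∧ ∀ (f : C(X, ℂ)) (y : Y),
      (y ∈ K → R f y = f (τ y)) ∧ (y ∉ K → R f y = star (f (τ y))) := by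
  let j : C(Y, ℂ) := R (algebraMap ℂ _ Complex.I)
  have hex : ∀ y, ∃ x, (j y = Complex.I ∧ ∀ f, R f y = f x) ∨
      (j y = -Complex.I ∧ ∀ f, R f y = star (f x)) := fun y =>
    exists_eq_apply_or_star_apply
      ((ContinuousMap.evalStarAlgHom ℂ ℂ y : C(Y, ℂ) →+* ℂ).comp R)
      fun f => congrArg (fun h : C(Y, ℂ) => h y) (hstar f)
  choose τ hτ using hex
  have hI : Complex.I ≠ -Complex.I := self_ne_neg.mpr Complex.I_ne_zero
  have hnorm : ∀ f y, ‖f (τ y)‖ = ‖R f y‖ := fun f y => by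
    rcases hτ y with ⟨-, h⟩ | ⟨-, h⟩
    · rw [h]
    · rw [h, norm_star]
  have hcont : Continuous τ := by
    rw [continuous_iff_continuousAt]
    intro y U hU
    obtain ⟨φ, hφ1, hφ0, -⟩ := exists_bump (s := (interior U)ᶜ) (y := τ y)
      isOpen_interior.isClosed_compl (by simpa using mem_interior_iff_mem_nhds.mpr hU)
    have hopen : IsOpen {z | 0 < ‖R φ z‖} := isOpen_lt (by fun_prop) (by fun_prop)
    refine Filter.mem_map.mpr (Filter.mem_of_superset (hopen.mem_nhds (x := y) ?_) fun z hz => ?_)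
    · simp [← hnorm, hφ1]
    · by_contra hzU
      rw [Set.mem_ofPred_eq, ← hnorm, hφ0 _ fun h => hzU (interior_subset (s := U) h)] at hz
      simp at hz
  have hinj : Function.Injective τ := by
    intro y z hyz
    by_contra hne
    obtain ⟨φ, hφ1, hφ0, -⟩ := exists_bump (isClosed_singleton (x := z)) (y := y) hne
    obtain ⟨f, rfl⟩ := hbij.2 φ
    have := hnorm f y
    rw [hyz, hnorm, hφ1, hφ0 z rfl] at this
    simp at this
  have hsurj : Function.Surjective τ := by
    intro x
    by_contra hx
    obtain ⟨φ, hφ1, hφ0, -⟩ := exists_bump (isCompact_range hcont).isClosed (y := x) hx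
    have : R φ = R 0 := by
      rw [map_zero]
      ext y
      rw [ContinuousMap.zero_apply, ← norm_eq_zero, ← hnorm, hφ0 _ ⟨y, rfl⟩, norm_zero]
    rw [hbij.1 this] at hφ1
    simp at hφ1
  have hK : {y | j y = Complex.I}ᶜ = {y | j y = -Complex.I} := by
    ext y
    rcases hτ y with ⟨h, -⟩ | ⟨h, -⟩
    · simp [h, hI]
    · simp [h, hI.symm]
  refine ⟨Continuous.homeoOfEquivCompactToT2 (f := Equiv.ofBijective τ ⟨hinj, hsurj⟩) hcont,
    {y | j y = Complex.I},
    ⟨isClosed_eq j.continuous continuous_const, isClosed_compl_iff.mp ?_⟩,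
    fun f y => ⟨fun hy => ?_, fun hy => ?_⟩⟩
  · rw [hK]
    exact isClosed_eq j.continuous continuous_const
  · rcases hτ y with ⟨-, h⟩ | ⟨h, -⟩
    · exact h f
    · exact absurd (hy.symm.trans h) hI
  · rcases hτ y with ⟨h, -⟩ | ⟨-, h⟩
    · exact absurd h hy
    · exact h f

theorem stmt15 (T : C(X, ℂ) → C(Y, ℂ)) (hbij : Function.Bijective T)
    (h1 : ∀ f g : C(X, ℂ), ‖T (f + g)‖ = ‖T f + T g‖)
    (h2 : ∀ f g : C(X, ℂ), ‖T (f * g)‖ = ‖T f * T g‖)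
    (h3 : ∀ f : C(X, ℂ), T (star f) = star (T f)) :
    ∃ (u : C(Y, ℝ)) (τ : Y ≃ₜ X) (K : Set Y), IsClopen K ∧
      (∀ y, u y = 1 ∨ u y = -1) ∧
      ∀ (f : C(X, ℂ)) (y : Y),
        (y ∈ K → T f y = (u y : ℂ) * f (τ y)) ∧
        (y ∉ K → T f y = (u y : ℂ) * star (f (τ y))) := by
  have hadd := map_add_of_norm_map_add_eq T hbij h1
  have h0 : T 0 = 0 := map_zero (AddMonoidHom.mk' T hadd)
  have hmul := norm_apply_map_mul_le T hbij h0 h2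
  have hs1 : star (T 1) = T 1 := by rw [← h3, star_one]
  have hle : ‖T 1‖ ≤ 1 := by
    have h := h2 1 1
    nth_rewrite 2 [← hs1] at h
    rw [mul_one, CStarRing.norm_self_mul_star] at h
    nlinarith [norm_nonneg (T 1)]
  let u : C(Y, ℝ) := ⟨fun y => (T 1 y).re, by fun_prop⟩
  have hu : ∀ y, T 1 y = (u y : ℂ) := fun y =>
    (Complex.conj_eq_iff_re.mp (DFunLike.congr_fun hs1 y)).symm
  have hu1 : ∀ y, u y = 1 ∨ u y = -1 := fun y => by
    obtain ⟨f, hf⟩ := hbij.2 1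
    have hge := hmul 1 f y
    have hle' := ((T 1).norm_coe_le_norm y).trans hle
    rw [one_mul, hf, ContinuousMap.one_apply, norm_one, mul_one] at hge
    rw [hu, Complex.norm_real, Real.norm_eq_abs] at hge hle'
    exact eq_or_eq_neg_of_abs_eq (le_antisymm hle' hge)
  have hsq : ∀ y, T 1 y * T 1 y = 1 := fun y => by
    rcases hu1 y with h | h <;> simp [hu, h]
  have hsq' : T 1 * T 1 = 1 := ContinuousMap.ext hsq
  have hn1 : ∀ y, ‖T 1 y‖ = 1 := fun y => by
    rcases hu1 y with h | h <;> simp [hu, h]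
  let R : C(X, ℂ) → C(Y, ℂ) := fun f => T 1 * T f
  have hRT : ∀ f, T 1 * R f = T f := fun f => by
    rw [← mul_assoc, hsq', one_mul]
  have hRbij : Function.Bijective R := by
    refine ⟨fun f g hfg => hbij.1 ?_, fun a => ?_⟩
    · rw [← hRT f, hfg, hRT]
    · obtain ⟨f, hf⟩ := hbij.2 (T 1 * a)
      exact ⟨f, by simp only [R]; rw [hf, ← mul_assoc, hsq', one_mul]⟩
  have hRadd : ∀ f g, R (f + g) = R f + R g := fun f g => by
    simp only [R, hadd, mul_add]
  have hRstar : ∀ f, R (star f) = star (R f) := fun f => by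
    simp only [R, h3, star_mul', hs1]
  have hRmul := map_mul_of_norm_apply_mul_le R hRbij hRadd hsq'
    (fun f g y => by simpa [R, hn1] using hmul f g y) hRstar
  obtain ⟨τ, K, hK, h⟩ := exists_homeomorph_of_star_ringHom
    { toFun := R
      map_one' := hsq'
      map_mul' := hRmul
      map_zero' := map_zero (AddMonoidHom.mk' R hRadd)
      map_add' := hRadd } hRbij hRstar
  refine ⟨u, τ, K, hK, hu1, fun f y => ⟨fun hy => ?_, fun hy => ?_⟩⟩
  · rw [← (h f y).1 hy, ← hu]
    exact (DFunLike.congr_fun (hRT f) y).symm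
  · rw [← (h f y).2 hy, ← hu]
    exact (DFunLike.congr_fun (hRT f) y).symm
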